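/- arXiv:1903.01732 — 6 statements merged into one kernel-verified Lean document; each statement's English description precedes it below -/
import Mathlib

section
/- Let n ≥ 2 and let w_1, …, w_n and z_{j,ui}, z_{j,uo}, z_{j,li}, z_{j,lo} (for j = 1, …, n) be complex numbers, with each z_{j,•} different from 0 and 1, satisfying the triangle equations w_j · z_{j,ui} · z_{j,uo} = 1 and w_j · z_{j,li} · z_{j,lo} = 1 for all j. Then the upper shingle equation z_{1,lo} · z_{n,li} · ∏_{j=2}^{n-1} z_{j,ui}' · z_{j,uo}'' · z_{j,uo}' · z_{j,ui}'' = 1 holds if and only if z_{n,lo} = z_{1,lo} · w_n^{-1} · ∏_{j=2}^{n-1} w_j, and also if and only if z_{n,li} = z_{1,li} · w_1 · ∏_{j=2}^{n-1} w_j^{-1}. -/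
/-- For a shape parameter `z`, the second shape parameter `z' = 1/(1-z)`. -/
noncomputable def shapeP (z : ℂ) : ℂ := 1 / (1 - z)

/-- For a shape parameter `z`, the third shape parameter `z'' = 1 - 1/z`. -/
noncomputable def shapePP (z : ℂ) : ℂ := 1 - 1 / z

theorem shapeP_mul_shapePP {z : ℂ} (h0 : z ≠ 0) (h1 : z ≠ 1) :
    shapeP z * shapePP z = -z⁻¹ := by
  have h : 1 - z ≠ 0 := sub_ne_zero.mpr h1.symm
  unfold shapeP shapePP
  field_simp
  ring

/-- At an intermediate crossing, the triangle equation turns the shape factor into `w`. -/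
theorem shape_factor_eq {w x y : ℂ} (hx0 : x ≠ 0) (hx1 : x ≠ 1) (hy0 : y ≠ 0) (hy1 : y ≠ 1)
    (h : w * x * y = 1) : shapeP x * shapePP y * shapeP y * shapePP x = w := by
  calc shapeP x * shapePP y * shapeP y * shapePP x
      = (shapeP x * shapePP x) * (shapeP y * shapePP y) := by ring
    _ = w := by
      rw [shapeP_mul_shapePP hx0 hx1, shapeP_mul_shapePP hy0 hy1]
      field_simp
      linear_combination -h

/-- Lemma 2.1 of the paper, upper shingle case: given the triangle equations
`w_j z_{j,ui} z_{j,uo} = 1` and `w_j z_{j,li} z_{j,lo} = 1` for `j = 1, …, n`,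
the upper shingle equation
`z_{1,lo} z_{n,li} ∏_{j=2}^{n-1} z_{j,ui}' z_{j,uo}'' z_{j,uo}' z_{j,ui}'' = 1`
holds iff `z_{n,lo} = z_{1,lo} w_n⁻¹ ∏_{j=2}^{n-1} w_j`, and also iff
`z_{n,li} = z_{1,li} w_1 ∏_{j=2}^{n-1} w_j⁻¹`. -/
theorem stmt_2 (n : ℕ) (hn : 2 ≤ n) (w zui zuo zli zlo : ℕ → ℂ)
    (hne : ∀ j ∈ Finset.Icc 1 n,
      (zui j ≠ 0 ∧ zui j ≠ 1) ∧ (zuo j ≠ 0 ∧ zuo j ≠ 1) ∧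
        (zli j ≠ 0 ∧ zli j ≠ 1) ∧ (zlo j ≠ 0 ∧ zlo j ≠ 1))
    (htri : ∀ j ∈ Finset.Icc 1 n,
      w j * zui j * zuo j = 1 ∧ w j * zli j * zlo j = 1) :
    ((zlo 1 * zli n *
        ∏ j ∈ Finset.Icc 2 (n - 1),
          (shapeP (zui j) * shapePP (zuo j) * shapeP (zuo j) * shapePP (zui j)) = 1) ↔
      zlo n = zlo 1 * (w n)⁻¹ * ∏ j ∈ Finset.Icc 2 (n - 1), w j) ∧
    ((zlo 1 * zli n *
        ∏ j ∈ Finset.Icc 2 (n - 1),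
          (shapeP (zui j) * shapePP (zuo j) * shapeP (zuo j) * shapePP (zui j)) = 1) ↔
      zli n = zli 1 * w 1 * ∏ j ∈ Finset.Icc 2 (n - 1), (w j)⁻¹) := by
  have hprod : ∏ j ∈ Finset.Icc 2 (n - 1),
      (shapeP (zui j) * shapePP (zuo j) * shapeP (zuo j) * shapePP (zui j)) =
      ∏ j ∈ Finset.Icc 2 (n - 1), w j := by
    refine Finset.prod_congr rfl fun j hj => ?_
    have hj' : j ∈ Finset.Icc 1 n := by
      rw [Finset.mem_Icc] at hj ⊢
      omega
    obtain ⟨⟨hx0, hx1⟩, ⟨hy0, hy1⟩, -⟩ := hne j hj'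
    exact shape_factor_eq hx0 hx1 hy0 hy1 (htri j hj').1
  have hw : ∀ j ∈ Finset.Icc 1 n, w j ≠ 0 := fun j hj h => by
    simpa [h] using (htri j hj).1
  have hP : ∏ j ∈ Finset.Icc 2 (n - 1), w j ≠ 0 := by
    refine Finset.prod_ne_zero_iff.mpr fun j hj => hw j ?_
    rw [Finset.mem_Icc] at hj ⊢
    omega
  have h1 : 1 ∈ Finset.Icc 1 n := Finset.mem_Icc.mpr ⟨le_rfl, by omega⟩
  have hn' : n ∈ Finset.Icc 1 n := Finset.mem_Icc.mpr ⟨by omega, le_rfl⟩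
  have hzlo1 : zlo 1 ≠ 0 := (hne 1 h1).2.2.2.1
  have hzlin : zli n ≠ 0 := (hne n hn').2.2.1.1
  have hwn := hw n hn'
  have htri1 := (htri 1 h1).2
  have htrin := (htri n hn').2
  rw [hprod, Finset.prod_inv_distrib]
  generalize ∏ j ∈ Finset.Icc 2 (n - 1), w j = P at hP ⊢
  constructor
  · have hzlon : zlo n = (w n * zli n)⁻¹ := eq_inv_of_mul_eq_one_right htrin
    rw [hzlon]
    field_simp
    constructor <;> intro h <;> linear_combination -h
  · have hzli1 : zli 1 * w 1 = (zlo 1)⁻¹ := eq_inv_of_mul_eq_one_left (by linear_combination htri1)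
    rw [hzli1]
    field_simp
end

section
/- Let n ≥ 2 and let w_1, …, w_n and z_{j,ui}, z_{j,uo}, z_{j,li}, z_{j,lo} (for j = 1, …, n) be complex numbers, with each z_{j,•} different from 0 and 1, satisfying the triangle equations w_j · z_{j,ui} · z_{j,uo} = 1 and w_j · z_{j,li} · z_{j,lo} = 1 for all j. Then the lower shingle equation z_{1,uo} · z_{n,ui} · ∏_{j=2}^{n-1} z_{j,li}'' · z_{j,lo}' · z_{j,lo}'' · z_{j,li}' = 1 holds if and only if z_{n,ui} = z_{1,ui} · w_1 · ∏_{j=2}^{n-1} w_j^{-1}, and also if and only if z_{n,uo} = z_{1,uo} · w_n^{-1} · ∏_{j=2}^{n-1} w_j. -/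
/-- If `w * x * y = 1`, the second and third shape parameters of `x` and `y` multiply to `w`. -/
theorem shapePP_mul_shapeP_mul_shapePP_mul_shapeP {w x y : ℂ} (hx0 : x ≠ 0) (hx1 : x ≠ 1)
    (hy0 : y ≠ 0) (hy1 : y ≠ 1) (h : w * x * y = 1) :
    shapePP x * shapeP y * shapePP y * shapeP x = w := by
  calc shapePP x * shapeP y * shapePP y * shapeP x
      = (shapeP x * shapePP x) * (shapeP y * shapePP y) := by ring
    _ = x⁻¹ * y⁻¹ := by
      rw [shapeP_mul_shapePP hx0 hx1, shapeP_mul_shapePP hy0 hy1, neg_mul_neg]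
    _ = w := by
      field_simp
      linear_combination -h

/-- Lemma 2.1 of the paper, lower shingle case: given the triangle equations
`w_j z_{j,ui} z_{j,uo} = 1` and `w_j z_{j,li} z_{j,lo} = 1` for `j = 1, …, n`,
the lower shingle equation
`z_{1,uo} z_{n,ui} ∏_{j=2}^{n-1} z_{j,li}'' z_{j,lo}' z_{j,lo}'' z_{j,li}' = 1`
holds iff `z_{n,ui} = z_{1,ui} w_1 ∏_{j=2}^{n-1} w_j⁻¹`, and also iff
`z_{n,uo} = z_{1,uo} w_n⁻¹ ∏_{j=2}^{n-1} w_j`. -/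
theorem stmt_3 (n : ℕ) (hn : 2 ≤ n) (w zui zuo zli zlo : ℕ → ℂ)
    (hne : ∀ j ∈ Finset.Icc 1 n,
      (zui j ≠ 0 ∧ zui j ≠ 1) ∧ (zuo j ≠ 0 ∧ zuo j ≠ 1) ∧
        (zli j ≠ 0 ∧ zli j ≠ 1) ∧ (zlo j ≠ 0 ∧ zlo j ≠ 1))
    (htri : ∀ j ∈ Finset.Icc 1 n,
      w j * zui j * zuo j = 1 ∧ w j * zli j * zlo j = 1) :
    ((zuo 1 * zui n *
        ∏ j ∈ Finset.Icc 2 (n - 1),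
          (shapePP (zli j) * shapeP (zlo j) * shapePP (zlo j) * shapeP (zli j)) = 1) ↔
      zui n = zui 1 * w 1 * ∏ j ∈ Finset.Icc 2 (n - 1), (w j)⁻¹) ∧
    ((zuo 1 * zui n *
        ∏ j ∈ Finset.Icc 2 (n - 1),
          (shapePP (zli j) * shapeP (zlo j) * shapePP (zlo j) * shapeP (zli j)) = 1) ↔
      zuo n = zuo 1 * (w n)⁻¹ * ∏ j ∈ Finset.Icc 2 (n - 1), w j) := by
  have hsub : ∀ j ∈ Finset.Icc 2 (n - 1), j ∈ Finset.Icc 1 n := by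
    intro j hj
    simp only [Finset.mem_Icc] at hj ⊢
    lia
  have hw : ∀ j ∈ Finset.Icc 1 n, w j ≠ 0 := fun j hj h => by
    simpa [h] using (htri j hj).1
  have h1 : 1 ∈ Finset.Icc 1 n := Finset.mem_Icc.mpr (by lia)
  have hn' : n ∈ Finset.Icc 1 n := Finset.mem_Icc.mpr (by lia)
  have hprod : ∏ j ∈ Finset.Icc 2 (n - 1),
      (shapePP (zli j) * shapeP (zlo j) * shapePP (zlo j) * shapeP (zli j)) =
        ∏ j ∈ Finset.Icc 2 (n - 1), w j := by
    refine Finset.prod_congr rfl fun j hj => ?_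
    obtain ⟨-, -, ⟨hi0, hi1⟩, ho0, ho1⟩ := hne j (hsub j hj)
    exact shapePP_mul_shapeP_mul_shapePP_mul_shapeP hi0 hi1 ho0 ho1 (htri j (hsub j hj)).2
  have hP : ∏ j ∈ Finset.Icc 2 (n - 1), w j ≠ 0 :=
    Finset.prod_ne_zero_iff.mpr fun j hj => hw j (hsub j hj)
  rw [hprod, Finset.prod_inv_distrib]
  generalize ∏ j ∈ Finset.Icc 2 (n - 1), w j = P at hP
  have ht1 := (htri 1 h1).1
  have htn := (htri n hn').1
  have hwn := hw n hn'
  have hzo : zuo 1 ≠ 0 := (hne 1 h1).2.1.1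
  have hzi : zui n ≠ 0 := (hne n hn').1.1
  constructor
  · rw [← div_eq_mul_inv, eq_div_iff hP, ← mul_right_inj' hzo (b := zui n * P)]
    rw [show zuo 1 * (zui 1 * w 1) = 1 by linear_combination ht1, mul_assoc]
  · rw [mul_right_comm (zuo 1) (w n)⁻¹, ← div_eq_mul_inv, eq_div_iff hwn,
      ← mul_right_inj' hzi (b := zuo n * w n)]
    rw [show zui n * (zuo n * w n) = 1 by linear_combination htn, eq_comm,
      show zui n * (zuo 1 * P) = zuo 1 * zui n * P by ring]
end

section
/- Let I be a finite index set and let w_μ be a nonzero complex number. For each c ∈ I let z_{a,c}, z_{a',c}, z_{b,c}, z_{b',c} be nonzero complex numbers, set w_c = z_{a',c}/z_{a,c} and assume z_{b,c}/z_{b',c} = w_c, and define z_{ui,c} = z_{a,c}/w_μ, z_{li,c} = 1/z_{b,c}, z_{uo,c} = w_μ/z_{a',c}, z_{lo,c} = z_{b',c}; assume each of these four numbers is different from 0 and 1. Then ∏_{c∈I} (z_{uo,c}'' · z_{ui,c}')/(z_{lo,c}' · z_{li,c}'') = ∏_{c∈I} w_c · ((1 - w_μ/z_{a',c})/(1 -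 w_μ/z_{a,c})) · ((1 - z_{b',c})/(1 - z_{b,c})). -/
/-- The identity rewriting the holonomy of the longitude (equation (2.8) of the paper)
in the form of equation (2.11): with `z_{ui} = z_a/w_μ`, `z_{li} = 1/z_b`,
`z_{uo} = w_μ/z_{a'}`, `z_{lo} = z_{b'}` and `w = z_{a'}/z_a = z_b/z_{b'}` at each crossing,
`∏_c (z_{uo}'' z_{ui}')/(z_{lo}' z_{li}'')
  = ∏_c w ((1 - w_μ/z_{a'})/(1 - w_μ/z_a)) ((1 - z_{b'})/(1 - z_b))`. -/
theorem stmt_4 (ι : Type) [Fintype ι] (wμ : ℂ) (hwμ : wμ ≠ 0)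
    (za za' zb zb' w zui zli zuo zlo : ι → ℂ)
    (hza : ∀ c, za c ≠ 0) (hza' : ∀ c, za' c ≠ 0)
    (hzb : ∀ c, zb c ≠ 0) (hzb' : ∀ c, zb' c ≠ 0)
    (hw : ∀ c, w c = za' c / za c) (hbw : ∀ c, zb c / zb' c = w c)
    (hui : ∀ c, zui c = za c / wμ) (hli : ∀ c, zli c = 1 / zb c)
    (huo : ∀ c, zuo c = wμ / za' c) (hlo : ∀ c, zlo c = zb' c)
    (hne : ∀ c, (zui c ≠ 0 ∧ zui c ≠ 1) ∧ (zli c ≠ 0 ∧ zli c ≠ 1) ∧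
      (zuo c ≠ 0 ∧ zuo c ≠ 1) ∧ (zlo c ≠ 0 ∧ zlo c ≠ 1)) :
    ∏ c, (shapePP (zuo c) * shapeP (zui c)) / (shapeP (zlo c) * shapePP (zli c)) =
      ∏ c, w c * ((1 - wμ / za' c) / (1 - wμ / za c)) * ((1 - zb' c) / (1 - zb c)) := by
  refine Finset.prod_congr rfl fun c _ => ?_
  have ha := hza c
  have ha' := hza' c
  have h_ui := (hne c).1.2
  rw [hui] at h_ui
  have h_a : za c - wμ ≠ 0 := fun h => h_ui (by rw [sub_eq_zero.mp h, div_self hwμ])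
  have h_a' : wμ - za c ≠ 0 := by rwa [← neg_sub, neg_ne_zero]
  rw [hw, hui, hli, huo, hlo]
  have h_out : shapePP (wμ / za' c) * shapeP (za c / wμ) =
      za' c / za c * ((1 - wμ / za' c) / (1 - wμ / za c)) := by
    unfold shapePP shapeP
    field_simp
    ring
  have h_low : shapeP (zb' c) * shapePP (1 / zb c) = (1 - zb c) / (1 - zb' c) := by
    simp only [shapePP, shapeP, one_div_one_div]
    ring
  rw [h_out, h_low, div_eq_mul_inv _ ((1 - zb c) / (1 - zb' c)), inv_div]
end

section
/- Let w, z_{ui}, z_{uo}, z_{li}, z_{lo} be complex numbers, each different from 0 and 1, satisfying the triangle equations w · z_{ui} · z_{uo} = 1 and w · z_{li} · z_{lo} = 1. Then (w' · z_{uo}'' · z_{lo}'') · (w'' · z_{uo}' · z_{li}') · (w' · z_{ui}'' · z_{li}'') · (w'' · z_{ui}' · z_{lo}') = 1. -/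
/-- The product of all four horizontal corner factors of the 5T-spine at a crossing
equals 1 (computation in the proof of Proposition 2.5 of the paper):
`(w' z_{uo}'' z_{lo}'')(w'' z_{uo}' z_{li}')(w' z_{ui}'' z_{li}'')(w'' z_{ui}' z_{lo}') = 1`,
given the triangle equations `w z_{ui} z_{uo} = 1` and `w z_{li} z_{lo} = 1`. -/
theorem stmt_5 (w zui zuo zli zlo : ℂ)
    (hw : w ≠ 0) (hw1 : w ≠ 1)
    (hui0 : zui ≠ 0) (hui1 : zui ≠ 1) (huo0 : zuo ≠ 0) (huo1 : zuo ≠ 1)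
    (hli0 : zli ≠ 0) (hli1 : zli ≠ 1) (hlo0 : zlo ≠ 0) (hlo1 : zlo ≠ 1)
    (htri1 : w * zui * zuo = 1) (htri2 : w * zli * zlo = 1) :
    (shapeP w * shapePP zuo * shapePP zlo) * (shapePP w * shapeP zuo * shapeP zli) *
      (shapeP w * shapePP zui * shapePP zli) * (shapePP w * shapeP zui * shapeP zlo) = 1 := by
  calc
    _ = (shapeP w * shapePP w) ^ 2 * (shapeP zui * shapePP zui) * (shapeP zuo * shapePP zuo) *
        (shapeP zli * shapePP zli) * (shapeP zlo * shapePP zlo) := by ring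
    _ = ((w * zui * zuo) * (w * zli * zlo))⁻¹ := by
      rw [shapeP_mul_shapePP hw hw1, shapeP_mul_shapePP hui0 hui1, shapeP_mul_shapePP huo0 huo1,
        shapeP_mul_shapePP hli0 hli1, shapeP_mul_shapePP hlo0 hlo1]
      field_simp
    _ = 1 := by rw [htri1, htri2, mul_one, inv_one]
end

section
/- Let w_μ, z_a, z_{a'}, z_b, z_{b'} be nonzero complex numbers, set w = z_{a'}/z_a and assume z_b/z_{b'} = w, and define z_{ui} = z_a/w_μ, z_{li} = 1/z_b, z_{uo} = w_μ/z_{a'}, z_{lo} = z_{b'}; assume w and each of the four defined numbers is different from 0 and 1. Then (1) (w'' · z_{ui}' · z_{lo}') · (w' · z_{ui}'' · z_{li}'') = (w_μ/z_{a'}) · (1 - z_b)/(1 - z_{b'}), and (2) (w' · z_{uo}'' · z_{li}'') · (w'' · z_{uo}' · z_{lo}') = (z_a/w_μ) · (1 - z_b)/(1 - z_{b'}). -/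
/-- The underpass factors `K_l` in the proof of Proposition 2.5 of the paper:
with `z_{ui} = z_a/w_μ`, `z_{li} = 1/z_b`, `z_{uo} = w_μ/z_{a'}`, `z_{lo} = z_{b'}`
and `w = z_{a'}/z_a = z_b/z_{b'}`,
(1) at a positive underpass
`(w'' z_{ui}' z_{lo}')(w' z_{ui}'' z_{li}'') = (w_μ/z_{a'})·(1 - z_b)/(1 - z_{b'})`,
(2) at a negative underpass
`(w' z_{uo}'' z_{li}'')(w'' z_{uo}' z_{lo}') = (z_a/w_μ)·(1 - z_b)/(1 - z_{b'})`. -/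
theorem stmt_7 (wμ za za' zb zb' w zui zli zuo zlo : ℂ)
    (hwμ : wμ ≠ 0) (hza : za ≠ 0) (hza' : za' ≠ 0) (hzb : zb ≠ 0) (hzb' : zb' ≠ 0)
    (hw : w = za' / za) (hbw : zb / zb' = w)
    (hui : zui = za / wμ) (hli : zli = 1 / zb) (huo : zuo = wμ / za') (hlo : zlo = zb')
    (hw0 : w ≠ 0) (hw1 : w ≠ 1)
    (hui0 : zui ≠ 0) (hui1 : zui ≠ 1) (hli0 : zli ≠ 0) (hli1 : zli ≠ 1)
    (huo0 : zuo ≠ 0) (huo1 : zuo ≠ 1) (hlo0 : zlo ≠ 0) (hlo1 : zlo ≠ 1) :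
    (shapePP w * shapeP zui * shapeP zlo) * (shapeP w * shapePP zui * shapePP zli) =
      (wμ / za') * ((1 - zb) / (1 - zb')) ∧
    (shapeP w * shapePP zuo * shapePP zli) * (shapePP w * shapeP zuo * shapeP zlo) =
      (za / wμ) * ((1 - zb) / (1 - zb')) := by
  have hl : shapePP zli * shapeP zlo = (1 - zb) / (1 - zb') := by
    rw [hli, hlo, shapeP, shapePP, one_div_one_div, mul_one_div]
  have key (z : ℂ) (h0 : z ≠ 0) (h1 : z ≠ 1) :
      (shapeP w * shapePP w) * (shapeP z * shapePP z) * (shapePP zli * shapeP zlo) =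
        (w * z)⁻¹ * ((1 - zb) / (1 - zb')) := by
    rw [shapeP_mul_shapePP hw0 hw1, shapeP_mul_shapePP h0 h1, hl, neg_mul_neg, mul_inv]
  have hu : (w * zui)⁻¹ = wμ / za' := by
    rw [hw, hui]
    field_simp
  have ho : (w * zuo)⁻¹ = za / wμ := by
    rw [hw, huo]
    field_simp
  constructor
  · rw [← hu, ← key zui hui0 hui1]
    ring
  · rw [← ho, ← key zuo huo0 huo1]
    ring
end

section
/- Let c ≥ 1 be an integer and suppose the set {1, 2, …, 2c} is partitioned into c pairs {j_i, j_i'} with j_i < j_i' for i = 1, …, c. In ℚ^{2c} with standard basis e_1, …, e_{2c}, define v_0 = Σ_{k=1}^{2c} e_k and, for i = 1, …, c, v_i = Σ_{k=j_i}^{j_i'-1} e_k. Then the family (v_0, v_1, …, v_c) is linearly independent over ℚ. -/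
/-- The linear-algebra claim in the proof of Proposition 2.4 of the paper: if
`{1, …, 2c}` is partitioned into `c` pairs `{jᵢ, jᵢ'}` with `jᵢ < jᵢ'`, then in `ℚ^{2c}`
(coordinates indexed by `k : Fin (2c)` representing the position `k+1`) the vectors
`v₀ = Σ_{k=1}^{2c} e_k` and `vᵢ = Σ_{k=jᵢ}^{jᵢ'-1} e_k` (for `i = 1, …, c`) are linearly
independent over `ℚ`. -/
theorem stmt_13 (c : ℕ) (hc : 1 ≤ c) (j j' : Fin c → ℕ)
    (hlt : ∀ i, j i < j' i)
    (hmem : ∀ i, j i ∈ Finset.Icc 1 (2 * c) ∧ j' i ∈ Finset.Icc 1 (2 * c))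
    (hpart : ∀ k ∈ Finset.Icc 1 (2 * c), ∃! i : Fin c, k = j i ∨ k = j' i) :
    LinearIndependent ℚ
      (Fin.cons (fun _ : Fin (2 * c) => (1 : ℚ))
        (fun (i : Fin c) (k : Fin (2 * c)) =>
          if j i ≤ (k : ℕ) + 1 ∧ (k : ℕ) + 1 < j' i then (1 : ℚ) else 0) :
        Fin (c + 1) → Fin (2 * c) → ℚ) := by
  have hinj : ∀ m i, j m = j i → m = i := fun m i h =>
    (hpart (j i) (hmem i).1).unique (Or.inl h.symm) (Or.inl rfl)
  simp only [Finset.mem_Icc] at hmem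
  rw [Fintype.linearIndependent_iff]
  intro g hg
  have hcoord : ∀ p, 1 ≤ p → p ≤ 2 * c →
      g 0 + ∑ i : Fin c, (if j i ≤ p ∧ p < j' i then g i.succ else 0) = 0 := by
    intro p hp hpc
    have h := congrFun hg ⟨p - 1, by omega⟩
    simpa [Fin.sum_univ_succ, Finset.sum_apply, Nat.sub_add_cancel hp] using h
  have hzero : g 0 = 0 := by
    have h := hcoord (2 * c) (by omega) le_rfl
    rwa [Finset.sum_eq_zero, add_zero] at h
    intro i _
    have := (hmem i).2.2
    exact if_neg (by omega)
  have hsucc : ∀ n i, j i = n → g (Fin.succ i) = 0 := by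
    intro n
    induction n using Nat.strong_induction_on with
    | _ n ih =>
      rintro i rfl
      have h := hcoord (j i) (hmem i).1.1 (hmem i).1.2
      rwa [hzero, zero_add, Finset.sum_eq_single i, if_pos ⟨le_rfl, hlt i⟩] at h
      · intro m _ hmi
        split_ifs with hm
        · exact ih (j m) (lt_of_le_of_ne hm.1 fun h' => hmi (hinj m i h')) m rfl
        · rfl
      · simp
  exact Fin.cases hzero fun i => hsucc _ i rfl
end
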